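/- Let S be a finite set, let h : S → ℝ with h_m ≥ 0 for all m ∈ S, and let σ² > 0. Then the SNR function γ : (S → ℝ) → ℝ defined by γ(p) = (1/σ²) · (∑_{m∈S} h_m · √(p_m))² is concave on the nonnegative orthant {p : S → ℝ | p_m ≥ 0 for all m ∈ S}. -/

import Mathlib

theorem convex_setOf_forall_nonneg (S : Type*) : Convex ℝ {p : S → ℝ | ∀ m, 0 ≤ p m} :=
  fun _ hp _ hq _ _ ha hb _ m => add_nonneg (mul_nonneg ha (hp m)) (mul_nonneg hb (hq m))

/-- Geometric means are superadditive under nonnegative weights (Cauchy–Schwarz). -/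
theorem mul_sqrt_mul_sqrt_add_le {a b x y u v : ℝ} (ha : 0 ≤ a) (hb : 0 ≤ b)
    (hx : 0 ≤ x) (hy : 0 ≤ y) (hu : 0 ≤ u) (hv : 0 ≤ v) :
    a * (√x * √y) + b * (√u * √v) ≤ √(a * x + b * u) * √(a * y + b * v) := by
  rw [← Real.sqrt_mul (x := a * x + b * u) (by positivity)]
  apply Real.le_sqrt_of_sq_le
  obtain ⟨s, hs⟩ : ∃ s, s = √x := ⟨_, rfl⟩
  obtain ⟨t, ht⟩ : ∃ t, t = √y := ⟨_, rfl⟩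
  obtain ⟨s', hs'⟩ : ∃ s', s' = √u := ⟨_, rfl⟩
  obtain ⟨t', ht'⟩ : ∃ t', t' = √v := ⟨_, rfl⟩
  rw [← hs, ← ht, ← hs', ← ht', ← Real.sq_sqrt hx, ← Real.sq_sqrt hy, ← Real.sq_sqrt hu,
    ← Real.sq_sqrt hv, ← hs, ← ht, ← hs', ← ht']
  nlinarith [mul_nonneg (mul_nonneg ha hb) (sq_nonneg (s * t' - s' * t))]

theorem concaveOn_sqrt_mul_sqrt {S : Type*} (i j : S) :
    ConcaveOn ℝ {p : S → ℝ | ∀ m, 0 ≤ p m} (fun p => √(p i) * √(p j)) :=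
  ⟨convex_setOf_forall_nonneg S, fun _ hp _ hq _ _ ha hb _ =>
    mul_sqrt_mul_sqrt_add_le ha hb (hp i) (hp j) (hq i) (hq j)⟩

/-- The coherent-combining SNR γ(p) = (1/σ²)(∑_{m∈S} h_m √(p_m))² is concave
on the nonnegative orthant. -/
theorem snr_concave_on_nonneg_orthant
    (S : Type*) [Fintype S] (h : S → ℝ) (hh : ∀ m, 0 ≤ h m)
    (σ2 : ℝ) (hσ2 : 0 < σ2) :
    ConcaveOn ℝ {p : S → ℝ | ∀ m, 0 ≤ p m}
      (fun p : S → ℝ => (1 / σ2) * (∑ m, h m * Real.sqrt (p m)) ^ 2) := by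
  have expand (p : S → ℝ) : (∑ m, h m * √(p m)) ^ 2 =
      ∑ i, ∑ j, h i * h j * (√(p i) * √(p j)) := by
    rw [sq, Finset.sum_mul_sum]
    exact Finset.sum_congr rfl fun i _ => Finset.sum_congr rfl fun j _ => by ring
  simp only [expand]
  refine ConcaveOn.smul (one_div_pos.2 hσ2).le
    ⟨convex_setOf_forall_nonneg S, fun p hp q hq a b ha hb hab => ?_⟩
  simp only [Finset.smul_sum, ← Finset.sum_add_distrib]
  exact Finset.sum_le_sum fun i _ => Finset.sum_le_sum fun j _ =>
    ((concaveOn_sqrt_mul_sqrt i j).smul (mul_nonneg (hh i) (hh j))).2 hp hq ha hb hab
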